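/- Let ρ be a two-qubit state, i.e., a positive semidefinite trace-1 matrix indexed by (Fin 2 × Fin 2). Then ρ admits a symmetric extension of rank one (a pure symmetric extension) if and only if the multiset of nonzero eigenvalues of ρ, counted with multiplicity, equals the multiset of nonzero eigenvalues of its reduced state ρ_B. -/

import Mathlib

open Matrix Kronecker ComplexOrder

noncomputable section

/-- `σ` is a symmetric extension of the bipartite state `ρ`:
`σ` is PSD, has trace 1, its partial trace over the third factor is `ρ`,
and it is invariant under swapping the two `B` factors. -/
def IsSymExt {A B : Type*} [Fintype A] [DecidableEq A] [Fintype B] [DecidableEq B]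
    (ρ : Matrix (A × B) (A × B) ℂ)
    (σ : Matrix (A × B × B) (A × B × B) ℂ) : Prop :=
  σ.PosSemidef ∧ σ.trace = 1 ∧
  (∀ a a' b b', ∑ c, σ (a, b, c) (a', b', c) = ρ (a, b) (a', b')) ∧
  (∀ a b₁ b₂ a' b₁' b₂', σ (a, b₁, b₂) (a', b₁', b₂') = σ (a, b₂, b₁) (a', b₂', b₁'))

/-- The reduced state on the second factor. -/
def reduceB {A B : Type*} [Fintype A] (ρ : Matrix (A × B) (A × B) ℂ) : Matrix B B ℂ :=
  fun b b' => ∑ a, ρ (a, b) (a, b')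

/-- The multiset of nonzero eigenvalues (with algebraic multiplicity). -/
def nonzeroSpec {n : Type*} [Fintype n] [DecidableEq n] (M : Matrix n n ℂ) : Multiset ℂ :=
  M.charpoly.roots.filter (· ≠ 0)

/-- The largest (real) eigenvalue of a matrix. -/
def lamMax {n : Type*} [Fintype n] [DecidableEq n] (M : Matrix n n ℂ) : ℝ :=
  sSup {x : ℝ | (x : ℂ) ∈ spectrum ℂ M}

/-- `ρ` admits a pure (rank-one) symmetric extension. -/
def PureExt {A B : Type*} [Fintype A] [DecidableEq A] [Fintype B] [DecidableEq B]
    (ρ : Matrix (A × B) (A × B) ℂ) : Prop :=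
  ∃ σ : Matrix (A × B × B) (A × B × B) ℂ, IsSymExt ρ σ ∧ σ.rank = 1

open Polynomial in
theorem nonzeroSpec_mul_comm {m n : Type*} [Fintype m] [DecidableEq m] [Fintype n] [DecidableEq n]
    (V : Matrix m n ℂ) (W : Matrix n m ℂ) : nonzeroSpec (V * W) = nonzeroSpec (W * V) := by
  have h := congrArg (fun p : ℂ[X] => p.roots.filter (· ≠ 0)) (charpoly_mul_comm' V W)
  have hz (k : ℕ) : (k • ({0} : Multiset ℂ)).filter (· ≠ 0) = 0 := by
    simp [Multiset.nsmul_singleton, Multiset.filter_eq_nil, Multiset.mem_replicate]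
  have hX (k : ℕ) {p : ℂ[X]} (hp : p.Monic) :
      (X ^ k * p).roots.filter (· ≠ 0) = p.roots.filter (· ≠ 0) := by
    rw [roots_mul (((monic_X_pow k).mul hp).ne_zero), roots_pow, roots_X, Multiset.filter_add,
      hz, zero_add]
  simpa only [nonzeroSpec, hX _ (charpoly_monic _)] using h

theorem nonzeroSpec_transpose {n : Type*} [Fintype n] [DecidableEq n] (M : Matrix n n ℂ) :
    nonzeroSpec Mᵀ = nonzeroSpec M := by
  rw [nonzeroSpec, charpoly_transpose, nonzeroSpec]

/-- Complex matrices of the same size with the same nonzero spectrum have the same determinant. -/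
theorem det_eq_of_nonzeroSpec_eq {n : Type*} [Fintype n] [DecidableEq n] {M N : Matrix n n ℂ}
    (h : nonzeroSpec M = nonzeroSpec N) : M.det = N.det := by
  have hcard (M : Matrix n n ℂ) : Multiset.card M.charpoly.roots = Fintype.card n := by
    rw [← (IsAlgClosed.splits M.charpoly).natDegree_eq_card_roots, charpoly_natDegree_eq_dim]
  have hroots (M : Matrix n n ℂ) :
      nonzeroSpec M + Multiset.replicate (Fintype.card n - Multiset.card (nonzeroSpec M)) 0 =
        M.charpoly.roots := by
    have hsplit := Multiset.filter_add_not (· ≠ (0 : ℂ)) M.charpoly.roots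
    have hrep : M.charpoly.roots.filter (fun x => ¬ x ≠ 0) =
        Multiset.replicate (M.charpoly.roots.count 0) 0 := by
      simp only [not_not]
      exact Multiset.filter_eq' _ _
    rw [hrep] at hsplit
    have hc := congrArg Multiset.card hsplit
    rw [Multiset.card_add, Multiset.card_replicate, hcard] at hc
    rw [← hc, nonzeroSpec, Nat.add_sub_cancel_left]
    exact hsplit
  rw [det_eq_prod_roots_charpoly, det_eq_prod_roots_charpoly, ← hroots M, ← hroots N, h]

theorem rank_eq_card_nonzeroSpec {n : Type*} [Fintype n] [DecidableEq n] {M : Matrix n n ℂ}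
    (hM : M.IsHermitian) : M.rank = Multiset.card (nonzeroSpec M) := by
  rw [hM.rank_eq_card_non_zero_eigs, nonzeroSpec, hM.roots_charpoly_eq_eigenvalues,
    Multiset.filter_map, Multiset.card_map, Fintype.card_subtype]
  simp [Finset.card_def]

theorem card_nonzeroSpec_le {n : Type*} [Fintype n] [DecidableEq n] (M : Matrix n n ℂ) :
    Multiset.card (nonzeroSpec M) ≤ Fintype.card n :=
  (Multiset.card_le_card (Multiset.filter_le _ _)).trans
    ((Polynomial.card_roots' _).trans_eq (charpoly_natDegree_eq_dim M))

/-- A positive semidefinite matrix of rank at most `card m` is `V * Vᴴ` for some `V` with columns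
indexed by `m`. -/
theorem Matrix.PosSemidef.exists_eq_mul_conjTranspose_of_rank_le {n m : Type*} [Fintype n]
    [DecidableEq n] [Fintype m] {M : Matrix n n ℂ} (hM : M.PosSemidef)
    (hr : M.rank ≤ Fintype.card m) : ∃ V : Matrix n m ℂ, M = V * Vᴴ := by
  classical
  rw [hM.1.rank_eq_card_non_zero_eigs] at hr
  obtain ⟨f⟩ := Function.Embedding.nonempty_of_card_le hr
  let W : Matrix n m ℂ := of fun s j =>
    if h : hM.1.eigenvalues s ≠ 0 then
      if f ⟨s, h⟩ = j then (Real.sqrt (hM.1.eigenvalues s) : ℂ) else 0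
    else 0
  have hW : W * Wᴴ = diagonal (RCLike.ofReal ∘ hM.1.eigenvalues) := by
    ext s t
    simp only [mul_apply, conjTranspose_apply, of_apply, W]
    by_cases hs : hM.1.eigenvalues s ≠ 0
    · by_cases ht : hM.1.eigenvalues t ≠ 0
      · by_cases hst : s = t
        · subst hst
          simp only [hs, ne_eq, not_false_eq_true, dite_true, diagonal_apply_eq,
            Function.comp_apply]
          simp [← Complex.ofReal_mul, Real.mul_self_sqrt (hM.eigenvalues_nonneg s)]
        · have : f ⟨t, ht⟩ ≠ f ⟨s, hs⟩ := fun h => hst (congrArg Subtype.val (f.injective h)).symm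
          simp [hs, ht, hst, this]
      · have hst : s ≠ t := fun h => ht (h ▸ hs)
        simp [ht, hst]
    · by_cases hst : s = t
      · subst hst
        simp [not_not.mp hs]
      · simp [hs, hst]
  refine ⟨(hM.1.eigenvectorUnitary : Matrix n n ℂ) * W, ?_⟩
  conv_lhs => rw [hM.1.spectral_theorem, Unitary.conjStarAlgAut_apply, ← hW]
  simp only [conjTranspose_mul, Matrix.mul_assoc, star_eq_conjTranspose]

/-- The real linear system in `z = x 0 + x 1 * I`, `w = x 2 + x 3 * I` expressing that `M a * U` is
symmetric for both `a`, where `U = !![z, -conj w; w, conj z]`. -/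
def symmSystem (M : Fin 2 → Matrix (Fin 2) (Fin 2) ℂ) : Matrix (Fin 4) (Fin 4) ℝ :=
  let L (a : Fin 2) : Fin 4 → ℂ := ![M a 1 0 - M a 0 1, Complex.I * (M a 1 0 + M a 0 1),
    M a 1 1 + M a 0 0, Complex.I * (M a 1 1 - M a 0 0)]
  of ![fun j => (L 0 j).re, fun j => (L 0 j).im, fun j => (L 1 j).re, fun j => (L 1 j).im]

set_option maxRecDepth 4000 in
set_option maxHeartbeats 1000000 in
theorem det_sub_det_eq_det_symmSystem (M : Fin 2 → Matrix (Fin 2) (Fin 2) ℂ) :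
    (∑ a, (M a)ᴴ * M a).det - (∑ a, M a * (M a)ᴴ).det = ((symmSystem M).det : ℂ) := by
  apply Complex.ext
  · rw [det_fin_two, det_fin_two, Complex.ofReal_re, det_succ_row_zero]
    simp only [Fin.sum_univ_four, det_fin_three, submatrix_apply]
    simp only [symmSystem, mul_apply, Fin.sum_univ_two, of_apply, Matrix.sum_apply, Fin.succAbove,
      conjTranspose_apply]
    simp
    ring
  · rw [Complex.ofReal_im]
    simp [det_fin_two, mul_apply]
    ring

/-- If `∑ a, M a * (M a)ᴴ` and `∑ a, (M a)ᴴ * M a` have the same determinant, then the two matrices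
`M a` become symmetric after right multiplication by a common unitary matrix. -/
theorem exists_unitary_forall_mul_symm (M : Fin 2 → Matrix (Fin 2) (Fin 2) ℂ)
    (h : (∑ a, (M a)ᴴ * M a).det = (∑ a, M a * (M a)ᴴ).det) :
    ∃ U : Matrix (Fin 2) (Fin 2) ℂ, U * Uᴴ = 1 ∧ ∀ a, (M a * U).IsSymm := by
  have hdet : (symmSystem M).det = 0 := by
    have := det_sub_det_eq_det_symmSystem M
    rw [h, sub_self] at this
    exact_mod_cast this.symm
  obtain ⟨x, hx0, hx⟩ := exists_mulVec_eq_zero_iff.mpr hdet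
  have hN : 0 < x 0 ^ 2 + x 1 ^ 2 + x 2 ^ 2 + x 3 ^ 2 := by
    by_contra! hle
    refine hx0 (funext fun i => ?_)
    fin_cases i <;> simp <;> nlinarith [sq_nonneg (x 0), sq_nonneg (x 1), sq_nonneg (x 2),
      sq_nonneg (x 3)]
  obtain ⟨r, hr⟩ : ∃ r : ℝ, r ^ 2 * (x 0 ^ 2 + x 1 ^ 2 + x 2 ^ 2 + x 3 ^ 2) = 1 :=
    ⟨(Real.sqrt (x 0 ^ 2 + x 1 ^ 2 + x 2 ^ 2 + x 3 ^ 2))⁻¹, by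
      rw [inv_pow, Real.sq_sqrt hN.le, inv_mul_cancel₀ hN.ne']⟩
  refine ⟨!![r * (⟨x 0, x 1⟩ : ℂ), -(r * (⟨x 2, -x 3⟩ : ℂ)); r * (⟨x 2, x 3⟩ : ℂ),
    r * (⟨x 0, -x 1⟩ : ℂ)], ?_, fun a => ?_⟩
  · ext i j
    fin_cases i <;> fin_cases j <;> apply Complex.ext <;>
      simp [mul_apply, Fin.sum_univ_succ] <;>
      first | ring1 | linear_combination hr
  · have key : (M a * !![r * (⟨x 0, x 1⟩ : ℂ), -(r * (⟨x 2, -x 3⟩ : ℂ)); r * (⟨x 2, x 3⟩ : ℂ),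
        r * (⟨x 0, -x 1⟩ : ℂ)]) 0 1 = (M a * !![r * (⟨x 0, x 1⟩ : ℂ), -(r * (⟨x 2, -x 3⟩ : ℂ));
        r * (⟨x 2, x 3⟩ : ℂ), r * (⟨x 0, -x 1⟩ : ℂ)]) 1 0 := by
      have h0 := congrFun hx 0
      have h1 := congrFun hx 1
      have h2 := congrFun hx 2
      have h3 := congrFun hx 3
      simp [symmSystem, mulVec, dotProduct, Fin.sum_univ_succ] at h0 h1 h2 h3
      fin_cases a <;> apply Complex.ext <;> simp [mul_apply, Fin.sum_univ_succ]
      · linear_combination (-r) * h0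
      · linear_combination (-r) * h1
      · linear_combination (-r) * h2
      · linear_combination (-r) * h3
    ext i j
    fin_cases i <;> fin_cases j
    · rfl
    · exact key.symm
    · exact key
    · rfl

/-- A factorization `ρ = V * Vᴴ` symmetric in the two `B` indices yields a pure extension. -/
theorem pureExt_mul_conjTranspose {A B : Type*} [Fintype A] [DecidableEq A] [Fintype B]
    [DecidableEq B] {V : Matrix (A × B) B ℂ} (htr : (V * Vᴴ).trace = 1)
    (hV : ∀ a b c, V (a, b) c = V (a, c) b) : PureExt (V * Vᴴ) := by
  let ψ : A × B × B → ℂ := fun x => V (x.1, x.2.1) x.2.2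
  have htrace : (vecMulVec ψ (star ψ)).trace = 1 := by
    rw [← htr]
    simp [trace, mul_apply, vecMulVec_apply, Fintype.sum_prod_type, ψ]
  refine ⟨vecMulVec ψ (star ψ), ⟨posSemidef_vecMulVec_self_star ψ, htrace, ?_, ?_⟩, ?_⟩
  · intro a a' b b'
    simp [mul_apply, vecMulVec_apply, ψ]
  · intro a b₁ b₂ a' b₁' b₂'
    simp [vecMulVec_apply, ψ, hV a b₁ b₂, hV a' b₁' b₂']
  · refine le_antisymm (rank_vecMulVec_le _ _) (Nat.one_le_iff_ne_zero.mpr fun h => ?_)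
    obtain ⟨W, hW⟩ := (posSemidef_vecMulVec_self_star ψ).exists_eq_mul_conjTranspose_of_rank_le
      (m := Empty) (by simp [h])
    simp [hW, trace, mul_apply] at htrace

/-- The spectrum condition is necessary in arbitrary dimensions. -/
theorem PureExt.nonzeroSpec_eq {A B : Type*} [Fintype A] [DecidableEq A] [Fintype B]
    [DecidableEq B] {ρ : Matrix (A × B) (A × B) ℂ} (h : PureExt ρ) :
    nonzeroSpec ρ = nonzeroSpec (reduceB ρ) := by
  obtain ⟨σ, ⟨hσ, -, hρ, hswap⟩, hrank⟩ := h
  obtain ⟨W, rfl⟩ := hσ.exists_eq_mul_conjTranspose_of_rank_le (m := Unit) (by simp [hrank])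
  let V : Matrix (A × B) B ℂ := of fun x c => W (x.1, x.2, c) ()
  have hV : ρ = V * Vᴴ := by
    ext ⟨a, b⟩ ⟨a', b'⟩
    rw [← hρ]
    simp [mul_apply, V]
  have hB : reduceB ρ = (Vᴴ * V)ᵀ := by
    ext b b'
    simp only [reduceB, ← hρ]
    simp_rw [hswap _ b _ _ b' _]
    simp [mul_apply, V, Fintype.sum_prod_type, mul_comm]
  rw [hB, nonzeroSpec_transpose, hV, nonzeroSpec_mul_comm]

/-- For two qubits, the spectrum condition is necessary and sufficient for a
pure symmetric extension. -/
theorem stmt_6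
    (ρ : Matrix (Fin 2 × Fin 2) (Fin 2 × Fin 2) ℂ)
    (hρ : ρ.PosSemidef) (hρtr : ρ.trace = 1) :
    PureExt ρ ↔ nonzeroSpec ρ = nonzeroSpec (reduceB ρ) := by
  refine ⟨PureExt.nonzeroSpec_eq, fun h => ?_⟩
  obtain ⟨V, rfl⟩ := hρ.exists_eq_mul_conjTranspose_of_rank_le (m := Fin 2) (by
    rw [rank_eq_card_nonzeroSpec hρ.1, h]
    exact card_nonzeroSpec_le _)
  let M : Fin 2 → Matrix (Fin 2) (Fin 2) ℂ := fun a => of fun b c => V (a, b) c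
  have hVV : ∑ a, (M a)ᴴ * M a = Vᴴ * V := by
    ext c c'
    simp [Matrix.sum_apply, mul_apply, M, Fintype.sum_prod_type]
  have hred : ∑ a, M a * (M a)ᴴ = reduceB (V * Vᴴ) := by
    ext b b'
    simp [Matrix.sum_apply, mul_apply, M, reduceB]
  obtain ⟨U, hU, hsymm⟩ := exists_unitary_forall_mul_symm M <| by
    rw [hVV, hred]
    exact det_eq_of_nonzeroSpec_eq (by rw [← nonzeroSpec_mul_comm, h])
  have hVU : V * Vᴴ = (V * U) * (V * U)ᴴ := by
    rw [conjTranspose_mul, Matrix.mul_assoc, ← Matrix.mul_assoc U, hU, Matrix.one_mul]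
  rw [hVU] at hρtr ⊢
  refine pureExt_mul_conjTranspose hρtr fun a b c => ?_
  simpa [mul_apply, M] using (hsymm a).apply c b
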